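/- Let R be a ring, m, n, u ∈ ℕ₊, and let w ∈ ((R^n)^m)^u be a filter bank. Define the reordered filter bank Ψ(w) ∈ ((R^{un})^m)^1 by ((Ψ(w)_1)_λ)_ν := ((w_{⌊(ν−1)/n⌋+1})_λ)_{((ν−1) mod n)+1} for ν ∈ {1,…,un} and λ ∈ {1,…,m}. Then for every non-empty signal ξ ∈ (R^m)^D (D ≥ 1), DUC_{Ψ(w)}(ξ) = TransposedConvolution_{(w, u, 0)}(ξ); that is, Dense Upsampling Convolution with the reordered filter bank equals transposed convolution with filter bank w, stride u, spatial filter extent u and zero padding size. -/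

import Mathlib

namespace Scan


/-- Multi-channel convolution `ξ ∗ w` of a signal `ξ ∈ (R^m)^D` with a filter bank
`w ∈ ((R^n)^m)^c`: in 1-based indexing, `(ξ ∗ w)_i = ∑_λ ∑_μ (w_μ)_λ · (ξ_{c+i−μ})_λ`. -/
def mconv {R : Type*} [Ring R] {m n c : ℕ} (w : Fin c → Fin m → Fin n → R)
    {D : ℕ} (ξ : Fin D → Fin m → R) : Fin (D + 1 - c) → Fin n → R :=
  fun i κ => ∑ lam : Fin m, ∑ μ : Fin c,
    w μ lam κ * ξ ⟨c - 1 - μ.val + i.val, by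
      have h1 := i.isLt; have h2 := μ.isLt; omega⟩ lam

/-- Zero padding: prepend and append `P` zero samples (Dirichlet boundary
conditions). -/
def padZ {V : Type*} [Zero V] (P : ℕ) {D : ℕ} (ξ : Fin D → V) : Fin (D + 2 * P) → V :=
  fun i => if h : P ≤ i.val ∧ i.val < P + D then ξ ⟨i.val - P, by omega⟩ else 0

/-- Cropping: remove `P` samples from both ends. -/
def crop {V : Type*} (P : ℕ) {D : ℕ} (ξ : Fin D → V) : Fin (D - 2 * P) → V :=
  fun i => ξ ⟨i.val + P, by have := i.isLt; omega⟩

/-- The spreading operator: insert `k − 1` zeros between the samples of the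
input signal. -/
def spread {V : Type*} [Zero V] (k : ℕ) {D : ℕ} (ξ : Fin D → V) :
    Fin (k * (D - 1) + 1) → V :=
  fun ν => if h : ν.val % k = 0 ∧ ν.val / k < D then ξ ⟨ν.val / k, h.2⟩ else 0

/-- The transposed convolution operator
`TransposedConvolution_{(w,k,P)}(ξ) = Crop_P(Pad_{c−1}(Spread_k(ξ)) ∗ w)`. -/
def transConv {R : Type*} [Ring R] {m n cc : ℕ} (w : Fin cc → Fin m → Fin n → R)
    (k P : ℕ) {D : ℕ} (ξ : Fin D → Fin m → R) :
    Fin (k * (D - 1) + 1 + 2 * (cc - 1) + 1 - cc - 2 * P) → Fin n → R :=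
  crop P (mconv w (padZ (cc - 1) (spread k ξ)))

/-- The upsampling operator with zero-order hold. -/
def upsample {M : Type*} (k : ℕ) {q : ℕ} (ξ : Fin q → M) : Fin (k * q) → M :=
  fun ν => ξ ⟨ν.val / k, Nat.div_lt_of_lt_mul ν.isLt⟩
/-- Vectorization operator: in 1-based indexing,
`vec(ξ)_j = ξ_{((j−1) mod a)+1, ⌊(j−1)/a⌋+1}`. -/
def vec {M : Type*} {a b : ℕ} (ξ : Fin a → Fin b → M) : Fin (a * b) → M :=
  fun j => ξ
    ⟨j.val % a, by
      rcases Nat.eq_zero_or_pos a with h | h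
      · exact absurd j.isLt (by simp [h])
      · exact Nat.mod_lt _ h⟩
    ⟨j.val / a, Nat.div_lt_of_lt_mul j.isLt⟩

/-- Inverse vectorization operator: in 1-based indexing,
`vec⁻¹(ξ)_{i,j} = ξ_{(j−1)a+i}`. -/
def vecInv {M : Type*} (a b : ℕ) (ξ : Fin (a * b) → M) : Fin a → Fin b → M :=
  fun i j => ξ ⟨j.val * a + i.val, by
    have h1 : j.val * a + i.val < j.val * a + a := Nat.add_lt_add_left i.isLt _
    have h2 : j.val * a + a ≤ b * a := by
      calc j.val * a + a = (j.val + 1) * a := by ring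
        _ ≤ b * a := Nat.mul_le_mul_right a j.isLt
    calc j.val * a + i.val < j.val * a + a := h1
      _ ≤ b * a := h2
      _ = a * b := Nat.mul_comm b a⟩

/-- Matrix transpose (fragmented signals are matrices, columns are fragments). -/
def mtrans {M : Type*} {a b : ℕ} (ξ : Fin a → Fin b → M) : Fin b → Fin a → M :=
  fun j i => ξ i j

/-- The fragmentation operator `Frag_k : M^{kq×s} → M^{q×ks}`,
`ξ ↦ (vec⁻¹_{ks×q}(vec_{s×kq}(ξᵀ)))ᵀ`. -/
def frag {M : Type*} (k : ℕ) {q s : ℕ} (ξ : Fin (k * q) → Fin s → M) :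
    Fin q → Fin (k * s) → M :=
  mtrans (vecInv (k * s) q (fun j => vec (mtrans ξ) (Fin.cast (by ring) j)))

/-- The defragmentation operator `Defrag_k : M^{q×ks} → M^{kq×s}`,
`ξ ↦ (vec⁻¹_{s×kq}(vec_{ks×q}(ξᵀ)))ᵀ`. -/
def defrag {M : Type*} (k : ℕ) {q s : ℕ} (ξ : Fin q → Fin (k * s) → M) :
    Fin (k * q) → Fin s → M :=
  mtrans (vecInv s (k * q) (fun j => vec (mtrans ξ) (Fin.cast (by ring) j)))

/-- The Dense Upsampling Convolution operator
`DUC_{w'}(ξ) = Φ⁻¹(Defrag_u(Φ(ξ ∗ w')))` for a filter bank `w'` of unit spatial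
extent mapping `m` input channels to `u·n` output channels (in the present
encoding of multi-channel signals the bijections `Φ`, `Φ⁻¹` are identities). -/
def duc {R : Type*} [Ring R] {m n u : ℕ} (w' : Fin 1 → Fin m → Fin (u * n) → R)
    {D : ℕ} (ξ : Fin D → Fin m → R) : Fin (u * (D + 1 - 1)) → Fin n → R :=
  defrag u (mconv w' ξ)

theorem mconv_unit_apply {R : Type*} [Ring R] {m n D : ℕ} (w : Fin 1 → Fin m → Fin n → R)
    (ξ : Fin D → Fin m → R) (i : Fin (D + 1 - 1)) (κ : Fin n) :
    mconv w ξ i κ = ∑ lam : Fin m, w 0 lam κ * ξ ⟨i.val, i.isLt⟩ lam := by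
  simp [mconv]

/-- Padding with `u - 1` zeros the signal spread by `u` gives, at the position which the filter
tap `μ` meets when computing output sample `i`, the input sample `i / u` if `μ = i % u`, and zero
otherwise. -/
theorem padZ_spread_apply {V : Type*} [Zero V] {u D : ℕ} (hu : 0 < u) (ξ : Fin D → V)
    (i μ : ℕ) (hi : i / u < D) (hμ : μ < u)
    (h : u - 1 - μ + i < u * (D - 1) + 1 + 2 * (u - 1)) :
    padZ (u - 1) (spread u ξ) ⟨u - 1 - μ + i, h⟩ = if μ = i % u then ξ ⟨i / u, hi⟩ else 0 := by
  have hdm := Nat.div_add_mod i u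
  have hle : u * (i / u) ≤ u * (D - 1) := Nat.mul_le_mul_left u (by omega)
  by_cases hc : μ = i % u
  · subst hc
    have hsub : u - 1 - i % u + i - (u - 1) = u * (i / u) := by omega
    have hpad : u - 1 ≤ u - 1 - i % u + i ∧
        u - 1 - i % u + i < u - 1 + (u * (D - 1) + 1) := by omega
    simp [padZ, spread, hpad, hsub, Nat.mul_div_cancel_left _ hu, hi]
  · rw [if_neg hc]
    unfold padZ
    split_ifs with hpad
    · refine dif_neg fun hspread => hc ?_
      dsimp only at hpad hspread
      have hsub : u - 1 - μ + i - (u - 1) = i - μ := by omega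
      rw [hsub] at hspread
      have hmod : μ ≡ i [MOD u] :=
        (Nat.modEq_iff_dvd' (by omega)).2 (Nat.dvd_of_mod_eq_zero hspread.1)
      rw [← hmod, Nat.mod_eq_of_lt hμ]
    · rfl

/-- Dense Upsampling Convolution with the reordered filter bank
`Ψ(w)` equals transposed convolution with filter bank `w`, stride `u`, spatial
filter extent `u` and vanishing padding size: the two outputs have the same
number `u·D` of samples and coincide sample-wise. -/
theorem duc_eq_transConv {R : Type*} [Ring R] (m n u : ℕ)
    (hm : 0 < m) (hn : 0 < n) (hu : 0 < u)
    (w : Fin u → Fin m → Fin n → R) {D : ℕ} (hD : 1 ≤ D) (ξ : Fin D → Fin m → R) :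
    (u * (D + 1 - 1) = u * (D - 1) + 1 + 2 * (u - 1) + 1 - u - 2 * 0) ∧
    (∀ (i : ℕ) (h1 : i < u * (D + 1 - 1))
      (h2 : i < u * (D - 1) + 1 + 2 * (u - 1) + 1 - u - 2 * 0),
      duc (fun (_ : Fin 1) (lam : Fin m) (ν : Fin (u * n)) =>
            w ⟨ν.val / n, Nat.div_lt_of_lt_mul
                (lt_of_lt_of_eq ν.isLt (Nat.mul_comm u n))⟩
              lam
              ⟨ν.val % n, Nat.mod_lt _ hn⟩)
          ξ ⟨i, h1⟩ =
        transConv w u 0 ξ ⟨i, h2⟩) := by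
  have hlen : u * D = u * (D - 1) + u := by
    rw [← Nat.mul_succ, Nat.succ_eq_add_one, Nat.sub_add_cancel hD]
  refine ⟨by rw [Nat.add_sub_cancel]; omega, fun i h1 h2 => funext fun κ => ?_⟩
  have hi : i / u < D := Nat.div_lt_of_lt_mul h1
  have hquot : (i * n + κ.val) / n = i := by
    rw [Nat.mul_comm, Nat.mul_add_div hn, Nat.div_eq_of_lt κ.isLt, Nat.add_zero]
  have htap : (i * n + κ.val) % (u * n) / n = i % u := by
    rw [Nat.mul_comm u n, Nat.mod_mul_right_div_self, hquot]
  have hchan : (i * n + κ.val) % (u * n) % n = κ.val := by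
    rw [Nat.mod_mul_left_mod, Nat.mul_comm, Nat.mul_add_mod, Nat.mod_eq_of_lt κ.isLt]
  have hsample : (i * n + κ.val) / (u * n) = i / u := by
    rw [Nat.mul_comm u n, ← Nat.div_div_eq_div_mul, hquot]
  trans ∑ lam : Fin m, w ⟨i % u, Nat.mod_lt _ hu⟩ lam κ * ξ ⟨i / u, hi⟩ lam
  · simp [duc, defrag, mtrans, vecInv, vec, mconv_unit_apply, htap, hchan, hsample]
  · refine Finset.sum_congr rfl fun lam _ => ?_
    rw [Finset.sum_eq_single ⟨i % u, Nat.mod_lt _ hu⟩]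
    · simp only [Nat.add_zero]
      rw [padZ_spread_apply hu ξ i _ hi (Nat.mod_lt _ hu), if_pos rfl]
    · intro μ _ hne
      simp only [Nat.add_zero]
      rw [padZ_spread_apply hu ξ i _ hi μ.isLt, if_neg fun h => hne (Fin.ext h), Pi.zero_apply,
        mul_zero]
    · exact fun h => absurd (Finset.mem_univ _) h

end Scan
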